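/- Let λ ∈ ℕ and let χ: ℝ² → ℝ be a fixed smooth function supported in an annulus A′ centred at the origin (so supp χ avoids a neighbourhood of 0), and set χ_λ(ξ) = χ(ξ/λ). Define the symmetric-2×2-tensor-valued kernel K_λ(h₁,h₂) = (1/(16(2π)⁴)) ∫_{ℝ²×ℝ²} [((ν₁−ν₂)⊗(ν₁−ν₂))/(|ν₁||ν₂|(|ν₁|+|ν₂|))] χ_λ(ν₁)χ_λ(ν₂) e^{i(ν₁·h₁+ν₂·h₂)} dν₁dν₂. Then K_λ is a Schwartz function on ℝ² × ℝ², and for every m ∈ ℕ, writing h̄ = (h₁,h₂) ∈ ℝ⁴, one has λ^m ∫_{ℝ²×ℝ²} |h̄|^m |K_λ(h₁,h₂)| dh₁dh₂ ≲_m λ^{−1}, with implicit constant depending only on m and χ. -/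

import Mathlib

/-!
Common setup: functions on the torus `𝕋^d = ℝ^d/(2πℤ)^d` are modelled as
`2π`-periodic functions on `ℝ^d = Fin d → ℝ`, with Fourier coefficients,
Fourier multiplier operators, Hölder norms, etc.
-/

noncomputable section

open scoped BigOperators
open MeasureTheory

/-- Points of `ℝ^d` (covering the torus `𝕋^d = ℝ^d/(2πℤ)^d`). -/
abbrev Vd (d : ℕ) := Fin d → ℝ

/-- The lattice vector `2π m`. -/
def latt {d : ℕ} (m : Fin d → ℤ) : Vd d := fun i => 2 * Real.pi * (m i : ℝ)

/-- `f` is `2π`-periodic in each coordinate, i.e. a function on the torus `𝕋^d`. -/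
def TorusFun {d : ℕ} {F : Type*} (f : Vd d → F) : Prop :=
  ∀ (x : Vd d) (m : Fin d → ℤ), f (x + latt m) = f x

/-- Dot product of an integer frequency with a point of `ℝ^d`. -/
def dotZ {d : ℕ} (k : Fin d → ℤ) (x : Vd d) : ℝ := ∑ i, (k i : ℝ) * x i

/-- The Euclidean norm on `ℝ^d`. -/
def eNorm {d : ℕ} (x : Vd d) : ℝ := Real.sqrt (∑ i, (x i) ^ 2)

/-- `|k|` for an integer frequency `k ∈ ℤ^d`. -/
def kAbs {d : ℕ} (k : Fin d → ℤ) : ℝ := eNorm (fun i => (k i : ℝ))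

/-- The fundamental domain `[0,2π]^d`. -/
def box (d : ℕ) : Set (Vd d) := Set.Icc 0 (fun _ => 2 * Real.pi)

/-- Mean-zero (real-valued) function on the torus. -/
def MeanZeroR {d : ℕ} (f : Vd d → ℝ) : Prop := ∫ x in box d, f x = 0

/-- Fourier coefficient `f̂(k)` of a function on the torus. -/
def fCoeff {d : ℕ} (f : Vd d → ℂ) (k : Fin d → ℤ) : ℂ :=
  (((2 * Real.pi) ^ d)⁻¹ : ℝ) • ∫ x in box d, f x * Complex.exp (-(Complex.I * (dotZ k x : ℂ)))

/-- Fourier multiplier operator with symbol `m : ℤ^d → ℂ`. -/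
def fmul {d : ℕ} (m : (Fin d → ℤ) → ℂ) (f : Vd d → ℂ) : Vd d → ℂ :=
  fun x => ∑' k : Fin d → ℤ, m k * fCoeff f k * Complex.exp (Complex.I * (dotZ k x : ℂ))

/-- `Λ^s = (-Δ)^{s/2}`: Fourier multiplier with symbol `|k|^s` (acting on mean-zero parts). -/
def LamPow {d : ℕ} (s : ℝ) : (Vd d → ℂ) → Vd d → ℂ :=
  fmul (fun k => if k = 0 then 0 else (((kAbs k) ^ s : ℝ) : ℂ))

/-- `Λ = (-Δ)^{1/2}`. -/
def Lam1 {d : ℕ} : (Vd d → ℂ) → Vd d → ℂ := LamPow 1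

/-- `i`-th component of the SQG operator `∇^⊥Λ^{-1} = (-∂₂Λ^{-1}, ∂₁Λ^{-1})`,
with symbols `(-i k₂/|k|, i k₁/|k|)`. -/
def sqgOp (i : Fin 2) : (Vd 2 → ℂ) → Vd 2 → ℂ :=
  fmul (fun k => if k = 0 then 0 else
    (if i = 0 then -(Complex.I * (k 1 : ℂ)) else Complex.I * (k 0 : ℂ)) / ((kAbs k : ℝ) : ℂ))

/-- First-order partial derivative `∂_i`. -/
def pd {d : ℕ} {F : Type*} [NormedAddCommGroup F] [NormedSpace ℝ F]
    (i : Fin d) (f : Vd d → F) (x : Vd d) : F :=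
  fderiv ℝ f x (Pi.single i 1)

/-- Complexification of a real-valued function. -/
def cplx {d : ℕ} (f : Vd d → ℝ) : Vd d → ℂ := fun x => (f x : ℂ)

/-- The `C^N` norm: sum of sup-norms of the iterated derivatives of order `≤ N`. -/
def CkNorm {d : ℕ} {F : Type*} [NormedAddCommGroup F] [NormedSpace ℝ F]
    (N : ℕ) (f : Vd d → F) : ℝ :=
  ∑ n ∈ Finset.range (N + 1), ⨆ x : Vd d, ‖iteratedFDeriv ℝ n f x‖

/-- The `α`-Hölder seminorm. -/
def hSemi {d : ℕ} {F : Type*} [NormedAddCommGroup F] (α : ℝ) (f : Vd d → F) : ℝ :=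
  ⨆ p : Vd d × Vd d, if p.1 = p.2 then 0 else ‖f p.1 - f p.2‖ / ‖p.1 - p.2‖ ^ α

/-- The `C^{N,α}` Hölder norm `‖f‖_{N+α}`. -/
def HolNorm {d : ℕ} {F : Type*} [NormedAddCommGroup F] [NormedSpace ℝ F]
    (N : ℕ) (α : ℝ) (f : Vd d → F) : ℝ :=
  CkNorm N f + hSemi α (iteratedFDeriv ℝ N f)

/-- `∇^⊥·div R` for a `2`-tensor field `R` on `ℝ²` (values in any normed space). -/
def perpDivDiv {F : Type*} [NormedAddCommGroup F] [NormedSpace ℝ F]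
    (R : Vd 2 → Fin 2 → Fin 2 → F) (x : Vd 2) : F :=
  - pd 1 (fun y => ∑ j, pd j (fun z => R z 0 j) y) x
  + pd 0 (fun y => ∑ j, pd j (fun z => R z 1 j) y) x

/-- Material derivative `D_t f = ∂_t f + u·∇f`. -/
def matD (u : ℝ → Vd 2 → Fin 2 → ℝ) (f : ℝ → Vd 2 → ℝ) (t : ℝ) (x : Vd 2) : ℝ :=
  deriv (fun s => f s x) t + ∑ i, u t x i * pd i (f t) x

/-- The SQG–Reynolds system `∂_tθ + u·∇θ = ∇^⊥·div R`, `u = ∇^⊥Λ^{-1}θ`,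
for smooth space-periodic data with `R` symmetric. -/
structure SQGReynolds (θ : ℝ → Vd 2 → ℝ) (u : ℝ → Vd 2 → Fin 2 → ℝ)
    (R : ℝ → Vd 2 → Fin 2 → Fin 2 → ℝ) : Prop where
  smooth_θ : ContDiff ℝ (⊤ : ℕ∞) fun p : ℝ × Vd 2 => θ p.1 p.2
  smooth_u : ContDiff ℝ (⊤ : ℕ∞) fun p : ℝ × Vd 2 => u p.1 p.2
  smooth_R : ContDiff ℝ (⊤ : ℕ∞) fun p : ℝ × Vd 2 => R p.1 p.2
  periodic_θ : ∀ t, TorusFun (θ t)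
  periodic_u : ∀ t, TorusFun (u t)
  periodic_R : ∀ t, TorusFun (R t)
  symm_R : ∀ t x i j, R t x i j = R t x j i
  vel : ∀ t x i, (u t x i : ℂ) = sqgOp i (cplx (θ t)) x
  eqn : ∀ t x, matD u θ t x = perpDivDiv (R t) x

/-- The bilinear operator `T[f,g] = Λ^{-1}((Λf)g - f(Λg))`. -/
def Tbil (f g : Vd 2 → ℂ) : Vd 2 → ℂ :=
  LamPow (-1) (fun x => Lam1 f x * g x - f x * Lam1 g x)

/-- A Littlewood–Paley bump: smooth, spherically symmetric, `ψ = 1` on `B₁(0)`,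
`supp ψ ⊂ B_{3/2}(0)`. -/
structure LPfun {d : ℕ} (ψ : Vd d → ℝ) : Prop where
  smooth : ContDiff ℝ (⊤ : ℕ∞) ψ
  radial : ∀ x y : Vd d, eNorm x = eNorm y → ψ x = ψ y
  supp : ∀ x, 3/2 ≤ eNorm x → ψ x = 0
  one : ∀ x, eNorm x ≤ 1 → ψ x = 1

/-- Littlewood–Paley block `Δ_j f` (with `Δ_{-1}f = f̂(0)`, `Δ_j f = 0` for `j < -1`). -/
def LPblock {d : ℕ} (ψ : Vd d → ℝ) (j : ℤ) (f : Vd d → ℂ) : Vd d → ℂ :=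
  if j < -1 then 0
  else if j = -1 then fun _ => fCoeff f 0
  else fun x => ∑' k : Fin d → ℤ,
    (((ψ (fun i => (k i : ℝ) / 2 ^ j) - ψ (fun i => (k i : ℝ) / 2 ^ (j - 1))) : ℝ) : ℂ)
      * fCoeff f k * Complex.exp (Complex.I * (dotZ k x : ℂ))

/-- Low-frequency projection `S_j f = Σ_{i ≤ j} Δ_i f`. -/
def LPlow {d : ℕ} (ψ : Vd d → ℝ) (j : ℤ) (f : Vd d → ℂ) : Vd d → ℂ :=
  if j < -1 then 0
  else if j = -1 then fun _ => fCoeff f 0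
  else fun x => ∑' k : Fin d → ℤ,
    ((ψ (fun i => (k i : ℝ) / 2 ^ j) : ℝ) : ℂ)
      * fCoeff f k * Complex.exp (Complex.I * (dotZ k x : ℂ))

/-- `∇Φ(x)^T ξ`, for an integer direction `ξ`. -/
def gradT (Φ : Vd 2 → Vd 2) (ξ : Fin 2 → ℤ) (x : Vd 2) : Vd 2 :=
  fun i => ∑ j, pd i (fun y => Φ y j) x * (ξ j : ℝ)

/-- The tensor-valued symbol
`K̂_λ(ν₁,ν₂) = (1/16) ((ν₁-ν₂)⊗(ν₁-ν₂))/(|ν₁||ν₂|(|ν₁|+|ν₂|)) χ(ν₁/λ)χ(ν₂/λ)`. -/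
def Khat (χ : Vd 2 → ℝ) (lam : ℕ) (ν₁ ν₂ : Vd 2) (i j : Fin 2) : ℝ :=
  (1/16) * ((ν₁ i - ν₂ i) * (ν₁ j - ν₂ j))
    / (eNorm ν₁ * eNorm ν₂ * (eNorm ν₁ + eNorm ν₂))
    * χ (fun l => ν₁ l / (lam : ℝ)) * χ (fun l => ν₂ l / (lam : ℝ))

/-- The physical-space kernel
`K_λ(h₁,h₂) = (1/(16(2π)⁴)) ∫ ((ν₁-ν₂)⊗(ν₁-ν₂))/(|ν₁||ν₂|(|ν₁|+|ν₂|)) χ_λ(ν₁)χ_λ(ν₂)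
e^{i(ν₁·h₁+ν₂·h₂)} dν₁dν₂` (the integrand below is `16·K̂_λ`). -/
def Kker (χ : Vd 2 → ℝ) (lam : ℕ) (h : Vd 2 × Vd 2) : Fin 2 → Fin 2 → ℂ :=
  fun i j => ((16 * (2 * Real.pi) ^ 4 : ℝ))⁻¹ •
    ∫ ν : Vd 2 × Vd 2,
      ((16 * Khat χ lam ν.1 ν.2 i j : ℝ) : ℂ)
        * Complex.exp (Complex.I * (((∑ l, ν.1 l * h.1 l) + ∑ l, ν.2 l * h.2 l : ℝ) : ℂ))

open scoped SchwartzMap FourierTransform ContDiff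

/-- The Fourier phase `ν₁·h₁ + ν₂·h₂`. -/
def fourierPhase (ν h : Vd 2 × Vd 2) : ℝ := (∑ l, ν.1 l * h.1 l) + ∑ l, ν.2 l * h.2 l

lemma fourierPhase_smul_left (c : ℝ) (ν h : Vd 2 × Vd 2) :
    fourierPhase (c • ν) h = fourierPhase ν (c • h) := by
  simp only [fourierPhase, Prod.smul_fst, Prod.smul_snd, Pi.smul_apply, smul_eq_mul,
    Fin.sum_univ_two]
  ring

/-- `ℝ⁴` with its Euclidean structure, split as `ℝ² × ℝ²`. -/
def euclideanProdEquiv : EuclideanSpace ℝ (Fin 2 ⊕ Fin 2) ≃L[ℝ] Vd 2 × Vd 2 :=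
  (EuclideanSpace.equiv (Fin 2 ⊕ Fin 2) ℝ).trans
    (ContinuousLinearEquiv.sumPiEquivProdPi ℝ (Fin 2) (Fin 2) fun _ => ℝ)

lemma measurePreserving_euclideanProdEquiv : MeasurePreserving euclideanProdEquiv :=
  (volume_measurePreserving_sumPiEquivProdPi fun _ : Fin 2 ⊕ Fin 2 => ℝ).comp
    (PiLp.volume_preserving_ofLp (Fin 2 ⊕ Fin 2))

lemma inner_eq_fourierPhase (v w : EuclideanSpace ℝ (Fin 2 ⊕ Fin 2)) :
    inner ℝ v w = fourierPhase (euclideanProdEquiv v) (euclideanProdEquiv w) := by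
  simp only [PiLp.inner_apply, fourierPhase, Fintype.sum_sum_type, RCLike.inner_apply, conj_trivial,
    mul_comm]
  rfl

/-- The unnormalised inverse Fourier transform of a smooth compactly supported function is a
Schwartz function. -/
lemma exists_schwartzMap_eq_integral_exp {F : Type*} [NormedAddCommGroup F] [NormedSpace ℂ F]
    [CompleteSpace F] (f : Vd 2 × Vd 2 → F) (hf : ContDiff ℝ ∞ f)
    (hfc : HasCompactSupport f) :
    ∃ S : 𝓢(Vd 2 × Vd 2, F), ∀ h,
      S h = ∫ ν, Complex.exp (Complex.I * (fourierPhase ν h : ℂ)) • f ν := by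
  let e := euclideanProdEquiv
  have hfe : HasCompactSupport (f ∘ e) := hfc.comp_homeomorph e.toHomeomorph
  let g : 𝓢(EuclideanSpace ℝ (Fin 2 ⊕ Fin 2), F) :=
    hfe.toSchwartzMap (hf.comp e.contDiff)
  let c : ℝˣ := Units.mk0 (2 * Real.pi)⁻¹ (by positivity)
  refine ⟨SchwartzMap.compCLMOfContinuousLinearEquiv ℂ
    ((ContinuousLinearEquiv.smulLeft c).trans e.symm) (𝓕⁻ g), fun h => ?_⟩
  rw [SchwartzMap.compCLMOfContinuousLinearEquiv_apply, Function.comp_apply,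
    SchwartzMap.fourierInv_coe, Real.fourierInv_eq',
    ← measurePreserving_euclideanProdEquiv.integral_comp
      euclideanProdEquiv.toHomeomorph.measurableEmbedding]
  refine integral_congr_ae (.of_forall fun v => ?_)
  have hphase : 2 * Real.pi * inner ℝ v (((ContinuousLinearEquiv.smulLeft c).trans e.symm) h)
      = fourierPhase (e v) h := by
    have hc : 2 * Real.pi * (2 * Real.pi)⁻¹ = 1 := mul_inv_cancel₀ (by positivity)
    have he : e (((ContinuousLinearEquiv.smulLeft c).trans e.symm) h)
        = (2 * Real.pi)⁻¹ • h := by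
      simp only [ContinuousLinearEquiv.trans_apply, ContinuousLinearEquiv.apply_symm_apply]
      rfl
    rw [inner_eq_fourierPhase]
    change _ * fourierPhase (e v) (e _) = _
    rw [he, ← fourierPhase_smul_left]
    simp only [fourierPhase, Prod.smul_fst, Prod.smul_snd, Pi.smul_apply, smul_eq_mul,
      Fin.sum_univ_two]
    linear_combination ((e v).1 0 * h.1 0 + (e v).1 1 * h.1 1
      + ((e v).2 0 * h.2 0 + (e v).2 1 * h.2 1)) * hc
  beta_reduce
  rw [hphase, mul_comm Complex.I]
  rfl

lemma integrable_exp_smul {F : Type*} [NormedAddCommGroup F] [NormedSpace ℂ F]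
    {f : Vd 2 × Vd 2 → F} (hf : Continuous f) (hfc : HasCompactSupport f) (h : Vd 2 × Vd 2) :
    Integrable fun ν => Complex.exp (Complex.I * (fourierPhase ν h : ℂ)) • f ν := by
  have hphase : Continuous fun ν => fourierPhase ν h := by
    unfold fourierPhase
    fun_prop
  refine Continuous.integrable_of_hasCompactSupport (by fun_prop) ?_
  exact hfc.smul_left (f := fun ν => Complex.exp (Complex.I * (fourierPhase ν h : ℂ)))

lemma continuous_eNorm {d : ℕ} : Continuous (eNorm : Vd d → ℝ) := by
  unfold eNorm
  fun_prop

lemma norm_le_eNorm {d : ℕ} (x : Vd d) : ‖x‖ ≤ eNorm x := by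
  refine (pi_norm_le_iff_of_nonneg (Real.sqrt_nonneg _)).2 fun i => ?_
  rw [Real.norm_eq_abs]
  exact Real.abs_le_sqrt
    (Finset.single_le_sum (f := fun i => x i ^ 2) (fun j _ => sq_nonneg _) (Finset.mem_univ i))

lemma eNorm_smul {d : ℕ} {c : ℝ} (hc : 0 ≤ c) (x : Vd d) : eNorm (c • x) = c * eNorm x := by
  simp only [eNorm, Pi.smul_apply, smul_eq_mul, mul_pow, ← Finset.mul_sum]
  rw [Real.sqrt_mul (sq_nonneg c), Real.sqrt_sq hc]

lemma contDiffAt_eNorm {d : ℕ} {x : Vd d} (hx : 0 < eNorm x) :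
    ContDiffAt ℝ ∞ (eNorm : Vd d → ℝ) x := by
  unfold eNorm
  exact ContDiffAt.sqrt (by fun_prop) (Real.sqrt_pos.1 hx).ne'

lemma Khat_eq_zero_left {χ : Vd 2 → ℝ} {ν₁ : Vd 2} (h : χ ν₁ = 0) (ν₂ : Vd 2) (i j : Fin 2) :
    Khat χ 1 ν₁ ν₂ i j = 0 := by
  simp [Khat, h]

lemma Khat_eq_zero_right {χ : Vd 2 → ℝ} {ν₂ : Vd 2} (h : χ ν₂ = 0) (ν₁ : Vd 2) (i j : Fin 2) :
    Khat χ 1 ν₁ ν₂ i j = 0 := by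
  simp [Khat, h]

lemma contDiff_Khat {χ : Vd 2 → ℝ} (hχ : ContDiff ℝ ∞ χ) {r : ℝ} (hr : 0 < r)
    (hsupp : ∀ x, χ x ≠ 0 → r ≤ eNorm x) (i j : Fin 2) :
    ContDiff ℝ ∞ fun ν : Vd 2 × Vd 2 => Khat χ 1 ν.1 ν.2 i j := by
  have hzero : ∀ x, eNorm x < r → χ x = 0 := fun x hx => by
    by_contra h
    exact (hsupp x h).not_gt hx
  refine contDiff_iff_contDiffAt.2 fun ν => ?_
  by_cases h₁ : eNorm ν.1 < r
  · refine (contDiffAt_const (c := (0 : ℝ))).congr_of_eventuallyEq ?_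
    filter_upwards [(continuous_eNorm.comp continuous_fst).continuousAt.eventually_lt_const h₁]
      with μ hμ
    exact Khat_eq_zero_left (hzero _ hμ) _ _ _
  by_cases h₂ : eNorm ν.2 < r
  · refine (contDiffAt_const (c := (0 : ℝ))).congr_of_eventuallyEq ?_
    filter_upwards [(continuous_eNorm.comp continuous_snd).continuousAt.eventually_lt_const h₂]
      with μ hμ
    exact Khat_eq_zero_right (hzero _ hμ) _ _ _
  have p₁ : 0 < eNorm ν.1 := hr.trans_le (not_lt.1 h₁)
  have p₂ : 0 < eNorm ν.2 := hr.trans_le (not_lt.1 h₂)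
  have e₁ : ContDiffAt ℝ ∞ (fun μ : Vd 2 × Vd 2 => eNorm μ.1) ν :=
    (contDiffAt_eNorm p₁).comp ν contDiffAt_fst
  have e₂ : ContDiffAt ℝ ∞ (fun μ : Vd 2 × Vd 2 => eNorm μ.2) ν :=
    (contDiffAt_eNorm p₂).comp ν contDiffAt_snd
  simp only [Khat, Nat.cast_one, div_one]
  refine ((ContDiffAt.div (by fun_prop) ((e₁.mul e₂).mul (e₁.add e₂)) ?_).mul ?_).mul ?_
  · positivity
  · exact (hχ.comp contDiff_fst).contDiffAt
  · exact (hχ.comp contDiff_snd).contDiffAt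

/-- Homogeneity of the symbol: it has degree `-1` under simultaneous scaling. -/
lemma Khat_smul (χ : Vd 2 → ℝ) {lam : ℕ} (hlam : lam ≠ 0) (ν₁ ν₂ : Vd 2) (i j : Fin 2) :
    Khat χ lam ((lam : ℝ) • ν₁) ((lam : ℝ) • ν₂) i j = (lam : ℝ)⁻¹ * Khat χ 1 ν₁ ν₂ i j := by
  have hl : (lam : ℝ) ≠ 0 := Nat.cast_ne_zero.2 hlam
  have hdiv : ∀ ν : Vd 2, (fun l => ((lam : ℝ) • ν) l / (lam : ℝ)) = ν := fun ν => by
    ext l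
    simp [hl]
  simp only [Khat, hdiv]
  simp only [eNorm_smul (Nat.cast_nonneg lam), Pi.smul_apply, smul_eq_mul,
    Nat.cast_one, div_one]
  have key : 1 / 16 * (((lam : ℝ) * ν₁ i - lam * ν₂ i) * (lam * ν₁ j - lam * ν₂ j))
      / (lam * eNorm ν₁ * (lam * eNorm ν₂) * (lam * eNorm ν₁ + lam * eNorm ν₂))
      = (lam : ℝ)⁻¹ * (1 / 16 * ((ν₁ i - ν₂ i) * (ν₁ j - ν₂ j))
        / (eNorm ν₁ * eNorm ν₂ * (eNorm ν₁ + eNorm ν₂))) := by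
    rw [show (1 : ℝ) / 16 * (((lam : ℝ) * ν₁ i - lam * ν₂ i) * (lam * ν₁ j - lam * ν₂ j))
        = lam ^ 2 * (1 / 16 * ((ν₁ i - ν₂ i) * (ν₁ j - ν₂ j))) by ring,
      show lam * eNorm ν₁ * (lam * eNorm ν₂) * (lam * eNorm ν₁ + lam * eNorm ν₂)
        = lam ^ 3 * (eNorm ν₁ * eNorm ν₂ * (eNorm ν₁ + eNorm ν₂)) by ring, mul_div_mul_comm]
    congr 1
    field_simp
  rw [key]
  ring

lemma Kker_apply (χ : Vd 2 → ℝ) (lam : ℕ) (h : Vd 2 × Vd 2) (i j : Fin 2) :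
    Kker χ lam h i j = ((16 * (2 * Real.pi) ^ 4 : ℝ))⁻¹ • ∫ ν : Vd 2 × Vd 2,
      ((16 * Khat χ lam ν.1 ν.2 i j : ℝ) : ℂ)
        * Complex.exp (Complex.I * (fourierPhase ν h : ℂ)) := rfl

instance isAddHaarMeasure_volume_prod :
    (volume : Measure (Vd 2 × Vd 2)).IsAddHaarMeasure :=
  Measure.prod.instIsAddHaarMeasure volume volume

lemma Kker_eq_smul (χ : Vd 2 → ℝ) {lam : ℕ} (hlam : lam ≠ 0) (h : Vd 2 × Vd 2) :
    Kker χ lam h = ((lam : ℝ) ^ 3) • Kker χ 1 ((lam : ℝ) • h) := by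
  have hl : (lam : ℝ) ≠ 0 := Nat.cast_ne_zero.2 hlam
  have hlC : (lam : ℂ) ≠ 0 := Nat.cast_ne_zero.2 hlam
  ext i j
  simp only [Pi.smul_apply, Kker_apply]
  rw [smul_comm]
  congr 1
  have hcv := Measure.integral_comp_smul (volume : Measure (Vd 2 × Vd 2))
    (fun ν => ((16 * Khat χ lam ν.1 ν.2 i j : ℝ) : ℂ)
        * Complex.exp (Complex.I * (fourierPhase ν h : ℂ))) (lam : ℝ)
  have hfin : Module.finrank ℝ (Vd 2 × Vd 2) = 4 := by simp
  rw [hfin, abs_of_nonneg (by positivity), eq_inv_smul_iff₀ (pow_ne_zero 4 hl)] at hcv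
  rw [← hcv, ← integral_smul, ← integral_smul]
  refine integral_congr_ae (.of_forall fun ν => ?_)
  simp only [Prod.smul_fst, Prod.smul_snd, Khat_smul χ hlam, fourierPhase_smul_left,
    Complex.real_smul]
  push_cast
  field_simp

lemma apply_zero_of_le_eNorm {d : ℕ} {χ : Vd d → ℝ} {r : ℝ} (hr : 0 < r)
    (hsupp : ∀ x, χ x ≠ 0 → r ≤ eNorm x) : χ 0 = 0 := by
  by_contra h
  have h_le : r ≤ 0 := by simpa [eNorm] using hsupp 0 h
  exact h_le.not_gt hr

lemma Kker_zero {χ : Vd 2 → ℝ} (h0 : χ 0 = 0) : Kker χ 0 = 0 := by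
  have : (fun _ => 0 : Vd 2) = 0 := rfl
  ext h i j
  simp [Kker, Khat, this, h0]

lemma exists_schwartzMap_eq_Kker_one {χ : Vd 2 → ℝ} (hχ : ContDiff ℝ ∞ χ) {r₁ r₂ : ℝ}
    (hr₁ : 0 < r₁) (hsupp : ∀ x, χ x ≠ 0 → r₁ ≤ eNorm x ∧ eNorm x ≤ r₂) :
    ∃ S : 𝓢(Vd 2 × Vd 2, Fin 2 → Fin 2 → ℂ), ∀ h, S h = Kker χ 1 h := by
  let f : Vd 2 × Vd 2 → Fin 2 → Fin 2 → ℂ :=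
    fun ν i j => ((16 * Khat χ 1 ν.1 ν.2 i j : ℝ) : ℂ)
  have hf : ContDiff ℝ ∞ f := by
    refine contDiff_pi.2 fun i => contDiff_pi.2 fun j => ?_
    exact Complex.ofRealCLM.contDiff.comp
      (contDiff_const.mul (contDiff_Khat hχ hr₁ (fun x hx => (hsupp x hx).1) i j))
  have hfc : HasCompactSupport f := by
    refine HasCompactSupport.intro (isCompact_closedBall 0 r₂) fun ν hν => ?_
    have hν' : r₂ < ‖ν‖ := by simpa using hν
    have hzero : ∀ x : Vd 2, r₂ < ‖x‖ → χ x = 0 := fun x hx => by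
      by_contra h
      exact ((norm_le_eNorm x).trans (hsupp x h).2).not_gt hx
    ext i j
    rcases lt_max_iff.1 (Prod.norm_def ν ▸ hν') with h | h
    · simp [f, Khat_eq_zero_left (hzero _ h)]
    · simp [f, Khat_eq_zero_right (hzero _ h)]
  obtain ⟨S, hS⟩ := exists_schwartzMap_eq_integral_exp f hf hfc
  refine ⟨((16 * (2 * Real.pi) ^ 4 : ℝ))⁻¹ • S, fun h => ?_⟩
  have hint := integrable_exp_smul hf.continuous hfc h
  ext i j
  have heval : (∫ ν, Complex.exp (Complex.I * (fourierPhase ν h : ℂ)) • f ν) i j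
      = ∫ ν, (Complex.exp (Complex.I * (fourierPhase ν h : ℂ)) • f ν) i j :=
    (congrFun (eval_integral (fun i => hint.eval i) i) j).trans
      (eval_integral (fun j => (hint.eval i).eval j) j)
  rw [smul_apply, hS, Pi.smul_apply, Pi.smul_apply, Kker_apply, heval]
  simp only [Pi.smul_apply, smul_eq_mul, f, mul_comm]

lemma exists_schwartzMap_eq_Kker {χ : Vd 2 → ℝ} (hχ : ContDiff ℝ ∞ χ) {r₁ r₂ : ℝ}
    (hr₁ : 0 < r₁) (hsupp : ∀ x, χ x ≠ 0 → r₁ ≤ eNorm x ∧ eNorm x ≤ r₂) (lam : ℕ) :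
    ∃ S : 𝓢(Vd 2 × Vd 2, Fin 2 → Fin 2 → ℂ), ⇑S = Kker χ lam := by
  rcases eq_or_ne lam 0 with rfl | hlam
  · refine ⟨0, ?_⟩
    rw [Kker_zero (apply_zero_of_le_eNorm hr₁ fun x hx => (hsupp x hx).1)]
    rfl
  obtain ⟨S, hS⟩ := exists_schwartzMap_eq_Kker_one hχ hr₁ hsupp
  let c : ℝˣ := Units.mk0 (lam : ℝ) (Nat.cast_ne_zero.2 hlam)
  refine ⟨((lam : ℝ) ^ 3) • SchwartzMap.compCLMOfContinuousLinearEquiv ℝ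
    (ContinuousLinearEquiv.smulLeft c) S, ?_⟩
  ext1 h
  rw [Kker_eq_smul χ hlam, ← hS]
  rfl

/-- For `χ` smooth and supported in an annulus centred at the origin,
the kernel `K_λ` is a Schwartz function on `ℝ²×ℝ²`, and for every `m ∈ ℕ` one has the
moment bound `λ^m ∫ |h̄|^m |K_λ(h₁,h₂)| dh₁dh₂ ≲_m λ^{-1}`, with constant depending
only on `m` and `χ`. -/
theorem kernel_schwartz_and_moment_bound
    (χ : Vd 2 → ℝ) (hχsm : ContDiff ℝ (⊤ : ℕ∞) χ)
    (r₁ r₂ : ℝ) (hr₁ : 0 < r₁) (hr₁₂ : r₁ ≤ r₂)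
    (hχsupp : ∀ x, χ x ≠ 0 → r₁ ≤ eNorm x ∧ eNorm x ≤ r₂) :
    (∀ lam : ℕ, ∀ k n : ℕ, ∃ C : ℝ, ∀ h : Vd 2 × Vd 2,
        ‖h‖ ^ k * ‖iteratedFDeriv ℝ n (Kker χ lam) h‖ ≤ C) ∧
    (∀ m : ℕ, ∃ C > 0, ∀ lam : ℕ,
        (lam : ℝ) ^ m * (∫ h : Vd 2 × Vd 2, ‖h‖ ^ m * ‖Kker χ lam h‖)
          ≤ C * (lam : ℝ)⁻¹) := by
  refine ⟨fun lam k n => ?_, fun m => ?_⟩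
  · obtain ⟨S, hS⟩ := exists_schwartzMap_eq_Kker hχsm hr₁ hχsupp lam
    rw [← hS]
    exact S.decay' k n
  set I : ℝ := ∫ h : Vd 2 × Vd 2, ‖h‖ ^ m * ‖Kker χ 1 h‖
  have hI : 0 ≤ I := integral_nonneg fun h => by positivity
  refine ⟨I + 1, by positivity, fun lam => ?_⟩
  rcases eq_or_ne lam 0 with rfl | hlam
  · simp [Kker_zero (apply_zero_of_le_eNorm hr₁ fun x hx => (hχsupp x hx).1)]
  have hl : (0 : ℝ) < lam := Nat.cast_pos.2 (Nat.pos_of_ne_zero hlam)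
  have hcv := Measure.integral_comp_smul (volume : Measure (Vd 2 × Vd 2))
    (fun h => ‖h‖ ^ m * ‖Kker χ 1 h‖) (lam : ℝ)
  have hfin : Module.finrank ℝ (Vd 2 × Vd 2) = 4 := by simp
  rw [hfin, abs_of_nonneg (by positivity), smul_eq_mul] at hcv
  have hscale : (lam : ℝ) ^ m * (∫ h : Vd 2 × Vd 2, ‖h‖ ^ m * ‖Kker χ lam h‖)
      = (lam : ℝ) ^ 3 * ∫ h : Vd 2 × Vd 2,
        ‖(lam : ℝ) • h‖ ^ m * ‖Kker χ 1 ((lam : ℝ) • h)‖ := by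
    rw [← integral_const_mul, ← integral_const_mul]
    refine integral_congr_ae (.of_forall fun h => ?_)
    simp only [Kker_eq_smul χ hlam h, norm_smul, norm_pow, Real.norm_natCast, mul_pow]
    ring
  rw [hscale, hcv]
  calc (lam : ℝ) ^ 3 * (((lam : ℝ) ^ 4)⁻¹ * I) = I * (lam : ℝ)⁻¹ := by field_simp
    _ ≤ (I + 1) * (lam : ℝ)⁻¹ := by gcongr; linarith
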